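/- (Conditional recursion for the sign process of the RWI.) For every n ≥ 0, almost surely E[ε_{n+1} | F_n] = (2p−1)·ε_n, where ε_n = 1_{S_n∈V_0} − 1_{S_n∈V_1}. -/

import Mathlib

open MeasureTheory ProbabilityTheory Real Filter Set
open scoped BigOperators NNReal

noncomputable section

namespace RWI

abbrev E : Type := EuclideanSpace ℝ (Fin 3)

def vec (x y z : ℝ) : E := (EuclideanSpace.equiv (Fin 3) ℝ).symm ![x, y, z]

/-- The two families of vertices of the `1h` ice lattice. -/
def V (a h : ℝ) (i : Fin 2) : Set E :=
  {v | ∃ k l n : ℤ, v = vec (a * ((i : ℕ) + (3 / 2) * k))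
      (a * ((Real.sqrt 3 / 2) * k + Real.sqrt 3 * l)) (h * n)}

/-- Horizontal jump from a vertex of type `i` in direction `j`. -/
def w (a : ℝ) (i : Fin 2) (j : Fin 3) : E :=
  vec (a * Real.cos (2 * (j : ℕ) * π / 3 + (i : ℕ) * π))
      (a * Real.sin (2 * (j : ℕ) * π / 3 + (i : ℕ) * π)) 0

/-- `S` is a random walk on ice with parameters `a, h, p, α, q` and natural filtration `F`. -/
structure IsRWI {Ω : Type} [MeasurableSpace Ω] (P : Measure Ω)
    (a h p α : ℝ) (q : Fin 2 → Fin 3 → ℝ)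
    (S : ℕ → Ω → E) (F : ℕ → MeasurableSpace Ω) : Prop where
  prob : IsProbabilityMeasure P
  ha : 0 < a
  hh : 0 < h
  hp0 : 0 ≤ p
  hp1 : p ≤ 1
  hα0 : 0 < α
  hα1 : α < 1
  hq : ∀ i j, 0 ≤ q i j
  hqsum : ∀ i, q i 0 + q i 1 + q i 2 = 1 - p
  hS0 : ∀ ω, S 0 ω = 0
  hSmeas : ∀ n, Measurable (S n)
  hF : ∀ n, F n =
    MeasurableSpace.comap (fun ω (k : Fin n) => S ((k : ℕ) + 1) ω - S (k : ℕ) ω)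
      MeasurableSpace.pi
  hTrans : ∀ (n : ℕ) (f : E → ℝ), Measurable f → (∃ C, ∀ x, |f x| ≤ C) →
    P[fun ω => f (S (n + 1) ω)|F n] =ᵐ[P]
      fun ω => ∑ i : Fin 2, (V a h i).indicator (fun _ => (1 : ℝ)) (S n ω) *
        (α * p * f (S n ω + vec 0 0 h) + (1 - α) * p * f (S n ω + vec 0 0 (-h)) +
          ∑ j : Fin 3, q i j * f (S n ω + w a i j))

def uu (q : Fin 2 → Fin 3 → ℝ) (i : Fin 2) : ℝ := q i 1 + q i 2

def vv (q : Fin 2 → Fin 3 → ℝ) (i : Fin 2) : ℝ := q i 1 - q i 2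

/-- The drift vector `μ` of the RWI. -/
def muI (a h p α : ℝ) (q : Fin 2 → Fin 3 → ℝ) : E :=
  vec (3 * a / 4 * (-(uu q 0) + uu q 1)) (a * Real.sqrt 3 / 4 * (vv q 0 - vv q 1))
    (h * p * (2 * α - 1))

/-- The vector `θ` of the RWI. -/
def thetaI (a p : ℝ) (q : Fin 2 → Fin 3 → ℝ) : E :=
  vec (a * ((1 - p) - 3 / 4 * (uu q 0 + uu q 1))) (a * Real.sqrt 3 / 4 * (vv q 0 + vv q 1)) 0

/-- The sign process `ε_n = 1_{S_n ∈ V_0} - 1_{S_n ∈ V_1}`. -/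
def epsI {Ω : Type} (a h : ℝ) (S : ℕ → Ω → E) (n : ℕ) (ω : Ω) : ℝ :=
  (V a h 0).indicator (fun _ => (1 : ℝ)) (S n ω) - (V a h 1).indicator (fun _ => (1 : ℝ)) (S n ω)

end RWI

namespace RWI

theorem vec_add (x y z x' y' z' : ℝ) :
    vec x y z + vec x' y' z' = vec (x + x') (y + y') (z + z') := by
  ext i
  fin_cases i <;> simp [vec]

theorem countable_V (a h : ℝ) (i : Fin 2) : (V a h i).Countable := by
  refine (countable_range fun t : ℤ × ℤ × ℤ =>
    vec (a * ((i : ℕ) + (3 / 2) * t.1))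
      (a * ((Real.sqrt 3 / 2) * t.1 + Real.sqrt 3 * t.2.1)) (h * t.2.2)).mono ?_
  rintro v ⟨k, l, n, rfl⟩
  exact ⟨(k, l, n), rfl⟩

theorem disjoint_V {a : ℝ} (ha : 0 < a) (h : ℝ) : Disjoint (V a h 0) (V a h 1) := by
  rw [Set.disjoint_left]
  rintro v ⟨k, l, n, rfl⟩ ⟨k', l', n', hv⟩
  have hx := congrArg (fun u : E => u 0) hv
  simp only [vec, EuclideanSpace.equiv, PiLp.continuousLinearEquiv_symm_apply,
    Matrix.cons_val_zero] at hx
  have hk := mul_left_cancel₀ ha.ne' hx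
  have hk_int : (3 * k : ℤ) = 2 + 3 * k' := by
    have : (3 * k : ℝ) = 2 + 3 * k' := by
      norm_num at hk
      linarith
    exact_mod_cast this
  omega

theorem add_vec_mem_V {a h : ℝ} {i : Fin 2} {v : E} (hv : v ∈ V a h i) (m : ℤ) :
    v + vec 0 0 (h * m) ∈ V a h i := by
  obtain ⟨k, l, n, rfl⟩ := hv
  refine ⟨k, l, n + m, ?_⟩
  rw [vec_add]
  push_cast
  congr 1 <;> ring

theorem cos_two_pi_div_three : Real.cos (2 * π / 3) = -1 / 2 := by
  rw [show 2 * π / 3 = π - π / 3 by ring, Real.cos_pi_sub, Real.cos_pi_div_three]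
  norm_num

theorem sin_two_pi_div_three : Real.sin (2 * π / 3) = Real.sqrt 3 / 2 := by
  rw [show 2 * π / 3 = π - π / 3 by ring, Real.sin_pi_sub, Real.sin_pi_div_three]

theorem cos_four_pi_div_three : Real.cos (2 * 2 * π / 3) = -1 / 2 := by
  rw [show 2 * 2 * π / 3 = π / 3 + π by ring, Real.cos_add_pi, Real.cos_pi_div_three]
  norm_num

theorem sin_four_pi_div_three : Real.sin (2 * 2 * π / 3) = -(Real.sqrt 3 / 2) := by
  rw [show 2 * 2 * π / 3 = π / 3 + π by ring, Real.sin_add_pi, Real.sin_pi_div_three]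

theorem add_w_zero_mem_V {a h : ℝ} {v : E} (hv : v ∈ V a h 0) (j : Fin 3) :
    v + w a 0 j ∈ V a h 1 := by
  obtain ⟨k, l, n, rfl⟩ := hv
  rw [w, vec_add]
  fin_cases j
  · refine ⟨k, l, n, ?_⟩
    simp
    congr 1; ring
  · refine ⟨k - 1, l + 1, n, ?_⟩
    simp [cos_two_pi_div_three, sin_two_pi_div_three]
    congr 1 <;> ring
  · refine ⟨k - 1, l, n, ?_⟩
    simp [cos_four_pi_div_three, sin_four_pi_div_three]
    congr 1 <;> ring

theorem add_w_one_mem_V {a h : ℝ} {v : E} (hv : v ∈ V a h 1) (j : Fin 3) :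
    v + w a 1 j ∈ V a h 0 := by
  obtain ⟨k, l, n, rfl⟩ := hv
  rw [w, vec_add]
  fin_cases j
  · refine ⟨k, l, n, ?_⟩
    simp
    congr 1; ring
  · refine ⟨k + 1, l - 1, n, ?_⟩
    simp [Real.cos_add_pi, Real.sin_add_pi, cos_two_pi_div_three, sin_two_pi_div_three]
    congr 1 <;> ring
  · refine ⟨k + 1, l, n, ?_⟩
    simp [Real.cos_add_pi, Real.sin_add_pi, cos_four_pi_div_three, sin_four_pi_div_three]
    congr 1 <;> ring

/-- The sign of a vertex: `1` on `V 0`, `-1` on `V 1`, and `0` off the lattice. -/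
def latticeSign (a h : ℝ) (v : E) : ℝ :=
  (V a h 0).indicator (fun _ => (1 : ℝ)) v - (V a h 1).indicator (fun _ => (1 : ℝ)) v

theorem latticeSign_of_mem_V_zero {a h : ℝ} (ha : 0 < a) {v : E} (hv : v ∈ V a h 0) :
    latticeSign a h v = 1 := by
  simp [latticeSign, hv, Set.disjoint_left.1 (disjoint_V ha h) hv]

theorem latticeSign_of_mem_V_one {a h : ℝ} (ha : 0 < a) {v : E} (hv : v ∈ V a h 1) :
    latticeSign a h v = -1 := by
  simp [latticeSign, hv, Set.disjoint_right.1 (disjoint_V ha h) hv]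

theorem measurable_latticeSign (a h : ℝ) : Measurable (latticeSign a h) :=
  (measurable_const.indicator (countable_V a h 0).measurableSet).sub
    (measurable_const.indicator (countable_V a h 1).measurableSet)

theorem abs_latticeSign_le (a h : ℝ) (v : E) : |latticeSign a h v| ≤ 1 := by
  by_cases h0 : v ∈ V a h 0 <;> by_cases h1 : v ∈ V a h 1 <;> simp [latticeSign, h0, h1]

/-- The one-step transition operator multiplies the lattice sign by `2 * p - 1`. -/
theorem transition_latticeSign {a h p α : ℝ} {q : Fin 2 → Fin 3 → ℝ} (ha : 0 < a)
    (hq : ∀ i, q i 0 + q i 1 + q i 2 = 1 - p) (v : E) :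
    ∑ i : Fin 2, (V a h i).indicator (fun _ => (1 : ℝ)) v *
        (α * p * latticeSign a h (v + vec 0 0 h) +
          (1 - α) * p * latticeSign a h (v + vec 0 0 (-h)) +
          ∑ j : Fin 3, q i j * latticeSign a h (v + w a i j)) =
      (2 * p - 1) * latticeSign a h v := by
  have hup : ∀ {i}, v ∈ V a h i → v + vec 0 0 h ∈ V a h i := fun hv => by
    simpa using add_vec_mem_V hv 1
  have hdown : ∀ {i}, v ∈ V a h i → v + vec 0 0 (-h) ∈ V a h i := fun hv => by
    simpa using add_vec_mem_V hv (-1)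
  rw [Fin.sum_univ_two]
  by_cases h0 : v ∈ V a h 0
  · have h1 := Set.disjoint_left.1 (disjoint_V ha h) h0
    simp only [Set.indicator_of_mem h0, Set.indicator_of_notMem h1, Fin.sum_univ_three,
      latticeSign_of_mem_V_zero ha h0, latticeSign_of_mem_V_zero ha (hup h0),
      latticeSign_of_mem_V_zero ha (hdown h0),
      latticeSign_of_mem_V_one ha (add_w_zero_mem_V h0 _)]
    linarith [hq 0]
  by_cases h1 : v ∈ V a h 1
  · simp only [Set.indicator_of_mem h1, Set.indicator_of_notMem h0, Fin.sum_univ_three,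
      latticeSign_of_mem_V_one ha h1, latticeSign_of_mem_V_one ha (hup h1),
      latticeSign_of_mem_V_one ha (hdown h1),
      latticeSign_of_mem_V_zero ha (add_w_one_mem_V h1 _)]
    linarith [hq 1]
  · simp [latticeSign, h0, h1]

end RWI

theorem rwi_condexp_sign {Ω : Type} [MeasurableSpace Ω] (P : Measure Ω)
    (a h p α : ℝ) (q : Fin 2 → Fin 3 → ℝ)
    (S : ℕ → Ω → RWI.E) (F : ℕ → MeasurableSpace Ω)
    (hRW : RWI.IsRWI P a h p α q S F) :
    ∀ n : ℕ, P[fun ω => RWI.epsI a h S (n + 1) ω|F n] =ᵐ[P]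
      fun ω => (2 * p - 1) * RWI.epsI a h S n ω := by
  intro n
  refine (hRW.hTrans n (RWI.latticeSign a h) (RWI.measurable_latticeSign a h)
    ⟨1, RWI.abs_latticeSign_le a h⟩).trans (Eventually.of_forall fun ω => ?_)
  exact RWI.transition_latticeSign hRW.ha hRW.hqsum (S n ω)
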